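/- arXiv:2504.12603 — 3 statements merged into one kernel-verified Lean document; each statement's English description precedes it below -/
import Mathlib

section
/- There exists a Mazurkiewicz set that is not a Hamel basis of ℝ²; indeed, there exists a Mazurkiewicz set containing the origin (0,0), and no Mazurkiewicz set containing (0,0) is a Hamel basis of ℝ². -/
open Cardinal Set

noncomputable section

/-- The line through `p` with direction `v`. -/
def lineThrough (p v : ℝ × ℝ) : Set (ℝ × ℝ) := {q | ∃ t : ℝ, q = p + t • v}

/-- `L` is a straight line of `ℝ²`. -/
def IsLine (L : Set (ℝ × ℝ)) : Prop := ∃ p v : ℝ × ℝ, v ≠ 0 ∧ L = lineThrough p v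

/-- `L` is a vertical line of `ℝ²`. -/
def IsVerticalLine (L : Set (ℝ × ℝ)) : Prop := ∃ x : ℝ, L = {p : ℝ × ℝ | p.1 = x}

/-- `L₁` and `L₂` are parallel lines. -/
def ParallelLines (L₁ L₂ : Set (ℝ × ℝ)) : Prop :=
  ∃ (p₁ p₂ v : ℝ × ℝ) (c : ℝ), v ≠ 0 ∧ c ≠ 0 ∧
    L₁ = lineThrough p₁ v ∧ L₂ = lineThrough p₂ (c • v)

/-- A Mazurkiewicz set meets every line in exactly two points. -/
def IsMazurkiewicz (M : Set (ℝ × ℝ)) : Prop :=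
  ∀ L : Set (ℝ × ℝ), IsLine L → (M ∩ L).encard = 2

/-- The graph of a partial function `g` defined on `S ⊆ ℝ`. -/
def graphOn (S : Set ℝ) (g : S → ℝ) : Set (ℝ × ℝ) := {p | ∃ x : S, p = ((x : ℝ), g x)}

/-- The graph of a function `f : ℝ → ℝ`. -/
def graphOf (f : ℝ → ℝ) : Set (ℝ × ℝ) := {p | ∃ x : ℝ, p = (x, f x)}

/-- A Sierpiński–Zygmund set. -/
def IsSZSet (X : Set (ℝ × ℝ)) : Prop :=
  ∀ (S : Set ℝ) (g : S → ℝ), Continuous g →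
    #↥(X ∩ graphOn S g) < Cardinal.continuum

/-- A Sierpiński–Zygmund function. -/
def IsSZFun (f : ℝ → ℝ) : Prop :=
  ∀ (S : Set ℝ) (g : S → ℝ), Continuous g →
    #↥{x : S | f x.1 = g x} < Cardinal.continuum

/-- Rotation about the origin by angle `θ`. -/
def rot (θ : ℝ) (p : ℝ × ℝ) : ℝ × ℝ :=
  (p.1 * Real.cos θ - p.2 * Real.sin θ, p.1 * Real.sin θ + p.2 * Real.cos θ)

/-- A Hamel basis of `ℝ²`: a basis of `ℝ × ℝ` as a vector space over `ℚ`. -/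
def IsHamelBasis (H : Set (ℝ × ℝ)) : Prop :=
  LinearIndependent ℚ ((↑) : H → ℝ × ℝ) ∧ Submodule.span ℚ H = ⊤

/-- A Hamel function: a function whose graph is a Hamel basis of `ℝ²`. -/
def IsHamelFun (h : ℝ → ℝ) : Prop := IsHamelBasis (graphOf h)

/-- Twice the signed area of the triangle `a b c`. -/
def signedArea (a b c : ℝ × ℝ) : ℝ :=
  (b.1 - a.1) * (c.2 - a.2) - (b.2 - a.2) * (c.1 - a.1)

/-- No three distinct points of `A` are collinear. -/
def NoThreeCollinear (A : Set (ℝ × ℝ)) : Prop :=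
  ∀ a ∈ A, ∀ b ∈ A, ∀ c ∈ A, a ≠ b → a ≠ c → b ≠ c → signedArea a b c ≠ 0

/-- `A` contains two distinct points of `L`. -/
def HasTwoPoints (A L : Set (ℝ × ℝ)) : Prop :=
  ∃ a ∈ A, ∃ b ∈ A, a ≠ b ∧ a ∈ L ∧ b ∈ L

theorem HasTwoPoints.mono {A B L : Set (ℝ × ℝ)} (h : HasTwoPoints A L) (hAB : A ⊆ B) :
    HasTwoPoints B L := by
  obtain ⟨a, ha, b, hb, hab, haL, hbL⟩ := h
  exact ⟨a, hAB ha, b, hAB hb, hab, haL, hbL⟩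

theorem signedArea_rotate (a b c : ℝ × ℝ) : signedArea b c a = signedArea a b c := by
  unfold signedArea; ring

theorem signedArea_add_smul (a b p v : ℝ × ℝ) (t : ℝ) :
    signedArea a b (p + t • v) =
      signedArea a b p + t * ((b.1 - a.1) * v.2 - (b.2 - a.2) * v.1) := by
  simp only [signedArea, Prod.fst_add, Prod.snd_add, Prod.smul_fst, Prod.smul_snd, smul_eq_mul]
  ring

theorem signedArea_eq_zero_of_mem_lineThrough {p v a b c : ℝ × ℝ} (ha : a ∈ lineThrough p v)
    (hb : b ∈ lineThrough p v) (hc : c ∈ lineThrough p v) : signedArea a b c = 0 := by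
  obtain ⟨r, rfl⟩ := ha
  obtain ⟨s, rfl⟩ := hb
  obtain ⟨t, rfl⟩ := hc
  simp only [signedArea, Prod.fst_add, Prod.snd_add, Prod.smul_fst, Prod.smul_snd, smul_eq_mul]
  ring

theorem mem_lineThrough_iff {p v q : ℝ × ℝ} (hv : v ≠ 0) :
    q ∈ lineThrough p v ↔ (q.1 - p.1) * v.2 = (q.2 - p.2) * v.1 := by
  constructor
  · rintro ⟨t, rfl⟩
    simp only [Prod.fst_add, Prod.snd_add, Prod.smul_fst, Prod.smul_snd, smul_eq_mul]
    ring
  · intro h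
    by_cases h1 : v.1 = 0
    · have h2 : v.2 ≠ 0 := fun h2 => hv (Prod.ext h1 h2)
      have hq : q.1 - p.1 = 0 := by simpa [h1, h2] using h
      refine ⟨(q.2 - p.2) / v.2, Prod.ext ?_ ?_⟩
      · simp [h1]; linarith
      · simp [h2]
    · refine ⟨(q.1 - p.1) / v.1, Prod.ext ?_ ?_⟩
      · simp [h1]
      · simp only [Prod.snd_add, Prod.smul_snd, smul_eq_mul]
        field_simp
        linarith

theorem add_smul_right_injective_of_ne_zero {p v : ℝ × ℝ} (hv : v ≠ 0) :
    Function.Injective fun t : ℝ => p + t • v :=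
  (add_right_injective p).comp (smul_left_injective ℝ hv)

/-- A line through two distinct points not both on `lineThrough p v` meets the latter at most
once. -/
theorem eq_of_signedArea_eq_zero {p v a b : ℝ × ℝ} (hv : v ≠ 0) (hab : a ≠ b)
    (hL : ¬ (a ∈ lineThrough p v ∧ b ∈ lineThrough p v)) {s t : ℝ}
    (hs : signedArea a b (p + s • v) = 0) (ht : signedArea a b (p + t • v) = 0) : s = t := by
  rw [signedArea_add_smul] at hs ht
  by_contra hst
  have hd : (b.1 - a.1) * v.2 - (b.2 - a.2) * v.1 = 0 := by
    have : (s - t) * ((b.1 - a.1) * v.2 - (b.2 - a.2) * v.1) = 0 := by linarith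
    exact (mul_eq_zero.1 this).resolve_left (sub_ne_zero.2 hst)
  have hp : signedArea a b p = 0 := by simpa [hd] using hs
  have hba : b - a ≠ 0 := sub_ne_zero.2 hab.symm
  unfold signedArea at hp
  have key : (a.1 - p.1) * v.2 = (a.2 - p.2) * v.1 := by
    by_cases h1 : b.1 - a.1 = 0
    · have h2 : b.2 - a.2 ≠ 0 := fun h2 => hba (Prod.ext h1 h2)
      apply mul_left_cancel₀ h2
      linear_combination v.2 * hp - (p.2 - a.2) * hd
    · apply mul_left_cancel₀ h1
      linear_combination v.1 * hp - (p.1 - a.1) * hd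
  refine hL ⟨(mem_lineThrough_iff hv).2 key, (mem_lineThrough_iff hv).2 ?_⟩
  linear_combination key + hd

theorem NoThreeCollinear.insert_of_signedArea_ne_zero {A : Set (ℝ × ℝ)} (hA : NoThreeCollinear A) {q : ℝ × ℝ}
    (hq : ∀ a ∈ A, ∀ b ∈ A, a ≠ b → signedArea a b q ≠ 0) : NoThreeCollinear (insert q A) := by
  rintro a (rfl | ha) b (rfl | hb) c (rfl | hc) hab hac hbc
  · exact absurd rfl hab
  · exact absurd rfl hab
  · exact absurd rfl hac
  · rw [← signedArea_rotate]
    exact hq b hb c hc hbc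
  · exact absurd rfl hbc
  · rw [← signedArea_rotate, ← signedArea_rotate]
    exact hq c hc a ha hac.symm
  · exact hq a ha b hb hab
  · exact hA a ha b hb c hc hab hac hbc

/-- A small set without three collinear points can be enlarged by a new point of any line that
does not yet contain two of its points. -/
theorem NoThreeCollinear.exists_insert {A : Set (ℝ × ℝ)} (hA : NoThreeCollinear A)
    (hcard : #A < 𝔠) {p v : ℝ × ℝ} (hv : v ≠ 0) (hL : ¬ HasTwoPoints A (lineThrough p v)) :
    ∃ q ∈ lineThrough p v, q ∉ A ∧ NoThreeCollinear (insert q A) := by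
  suffices h : ∃ t : ℝ, p + t • v ∉ A ∧
      ∀ a ∈ A, ∀ b ∈ A, a ≠ b → signedArea a b (p + t • v) ≠ 0 by
    obtain ⟨t, htA, ht⟩ := h
    exact ⟨_, ⟨t, rfl⟩, htA, hA.insert_of_signedArea_ne_zero ht⟩
  by_contra! hbad
  have hpair : ∀ t : ℝ, ∃ x : A × A, (x.1 = x.2 ∧ p + t • v = x.1) ∨
      (x.1 ≠ x.2 ∧ signedArea x.1 x.2 (p + t • v) = 0) := by
    intro t
    by_cases ht : p + t • v ∈ A
    · exact ⟨(⟨_, ht⟩, ⟨_, ht⟩), Or.inl ⟨rfl, rfl⟩⟩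
    · obtain ⟨a, ha, b, hb, hab, h⟩ := hbad t ht
      exact ⟨(⟨a, ha⟩, ⟨b, hb⟩), Or.inr ⟨fun h => hab (congrArg Subtype.val h), h⟩⟩
  choose f hf using hpair
  have hinj : Function.Injective f := by
    intro s t hst
    have hs := hf s
    have ht := hf t
    rw [hst] at hs
    rcases hs with ⟨hne, hs⟩ | ⟨hne, hs⟩ <;> rcases ht with ⟨hne', ht⟩ | ⟨hne', ht⟩
    · exact add_smul_right_injective_of_ne_zero hv (hs.trans ht.symm)
    · exact absurd hne hne'
    · exact absurd hne' hne
    · have hne'' : ((f t).1 : ℝ × ℝ) ≠ (f t).2 := fun h => hne (Subtype.ext h)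
      exact eq_of_signedArea_eq_zero hv hne''
        (fun h => hL ⟨_, (f t).1.2, _, (f t).2.2, hne'', h⟩) hs ht
  have h1 := Cardinal.mk_le_of_injective hinj
  rw [Cardinal.mk_real, Cardinal.mk_prod, Cardinal.lift_id] at h1
  exact absurd h1 (not_le.2 (Cardinal.mul_lt_of_lt Cardinal.aleph0_le_continuum hcard hcard))

theorem NoThreeCollinear.exists_union_hasTwoPoints {A : Set (ℝ × ℝ)} (hA : NoThreeCollinear A)
    (hcard : #A < 𝔠) {p v : ℝ × ℝ} (hv : v ≠ 0) :
    ∃ S : Finset (ℝ × ℝ), NoThreeCollinear (A ∪ S) ∧ HasTwoPoints (A ∪ S) (lineThrough p v) := by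
  classical
  by_cases h0 : HasTwoPoints A (lineThrough p v)
  · exact ⟨∅, by simpa using hA, by simpa using h0⟩
  obtain ⟨q, hqL, hqA, hq⟩ := hA.exists_insert hcard hv h0
  by_cases h1 : HasTwoPoints (insert q A) (lineThrough p v)
  · exact ⟨{q}, by simpa using hq, by simpa using h1⟩
  have hcard' : #(insert q A : Set (ℝ × ℝ)) < 𝔠 :=
    Cardinal.mk_insert_le.trans_lt
      (Cardinal.add_lt_of_lt Cardinal.aleph0_le_continuum hcard
        (Cardinal.one_lt_aleph0.trans_le Cardinal.aleph0_le_continuum))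
  obtain ⟨r, hrL, hrA, hr⟩ := hq.exists_insert hcard' hv h1
  have hU : A ∪ (({r, q} : Finset (ℝ × ℝ)) : Set (ℝ × ℝ)) = insert r (insert q A) := by
    rw [union_comm]; simp [insert_union]
  refine ⟨{r, q}, by rwa [hU], ?_⟩
  rw [hU]
  exact ⟨r, by simp, q, by simp, fun h => hrA (by simp [h]), hrL, hqL⟩

/-- A set without three collinear points that contains two points of every line is a
Mazurkiewicz set. -/
theorem NoThreeCollinear.isMazurkiewicz {M : Set (ℝ × ℝ)} (hM : NoThreeCollinear M)
    (h : ∀ p v : ℝ × ℝ, v ≠ 0 → HasTwoPoints M (lineThrough p v)) : IsMazurkiewicz M := by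
  rintro _ ⟨p, v, hv, rfl⟩
  obtain ⟨a, ha, b, hb, hab, haL, hbL⟩ := h p v hv
  have : M ∩ lineThrough p v = {a, b} := by
    ext c
    constructor
    · rintro ⟨hc, hcL⟩
      by_contra hne
      rw [mem_insert_iff, mem_singleton_iff, not_or] at hne
      exact hM a ha b hb c hc hab (Ne.symm hne.1) (Ne.symm hne.2)
        (signedArea_eq_zero_of_mem_lineThrough haL hbL hcL)
    · rintro (rfl | rfl)
      exacts [⟨ha, haL⟩, ⟨hb, hbL⟩]
  rw [this, encard_pair hab]

/-- A union over a linear order has no three collinear points if all its initial parts do. -/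
theorem NoThreeCollinear.biUnion {I : Type*} [LinearOrder I] {F : I → Set (ℝ × ℝ)} {s : Set I}
    (h : ∀ j ∈ s, NoThreeCollinear (⋃ i ∈ Iic j, F i)) : NoThreeCollinear (⋃ i ∈ s, F i) := by
  intro a ha b hb c hc
  simp only [mem_iUnion, exists_prop] at ha hb hc
  obtain ⟨i, hi, ha⟩ := ha
  obtain ⟨j, hj, hb⟩ := hb
  obtain ⟨k, hk, hc⟩ := hc
  have hm : max i (max j k) ∈ s := by
    rcases max_choice i (max j k) with h | h <;> rw [h]
    · exact hi
    · rcases max_choice j k with h | h <;> rw [h] <;> assumption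
  exact h _ hm a (mem_biUnion (le_max_left _ _) ha)
    b (mem_biUnion ((le_max_left _ _).trans (le_max_right _ _)) hb)
    c (mem_biUnion ((le_max_right _ _).trans (le_max_right _ _)) hc)

theorem exists_isMazurkiewicz : ∃ M : Set (ℝ × ℝ), IsMazurkiewicz M := by
  have hext : ∀ (A : Set (ℝ × ℝ)) (l : (ℝ × ℝ) × (ℝ × ℝ)), ∃ S : Finset (ℝ × ℝ),
      NoThreeCollinear A → #A < 𝔠 → l.2 ≠ 0 →
        NoThreeCollinear (A ∪ S) ∧ HasTwoPoints (A ∪ S) (lineThrough l.1 l.2) := by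
    intro A l
    by_cases h : NoThreeCollinear A ∧ #A < 𝔠 ∧ l.2 ≠ 0
    · obtain ⟨S, hS⟩ := h.1.exists_union_hasTwoPoints h.2.1 (p := l.1) h.2.2
      exact ⟨S, fun _ _ _ => hS⟩
    · exact ⟨∅, fun h1 h2 h3 => absurd ⟨h1, h2, h3⟩ h⟩
  choose ext hext using hext
  have hcardLines : #{l : (ℝ × ℝ) × (ℝ × ℝ) // l.2 ≠ 0} ≤ #(continuum.ord.ToType) := by
    refine (Cardinal.mk_subtype_le _).trans ?_
    simp [Cardinal.mk_real]
  have : Nonempty {l : (ℝ × ℝ) × (ℝ × ℝ) // l.2 ≠ 0} := ⟨⟨(0, (1, 0)), by simp⟩⟩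
  obtain ⟨g⟩ := hcardLines
  let line : continuum.ord.ToType → {l : (ℝ × ℝ) × (ℝ × ℝ) // l.2 ≠ 0} := Function.invFun g
  have hline : Function.Surjective line := Function.invFun_surjective g.injective
  let F : continuum.ord.ToType → Finset (ℝ × ℝ) :=
    WellFoundedLT.fix fun i G => ext (⋃ j : Iio i, (G j j.2 : Set (ℝ × ℝ))) (line i)
  have hF : ∀ i, F i = ext (⋃ j ∈ Iio i, (F j : Set (ℝ × ℝ))) (line i) := by
    intro i
    rw [biUnion_eq_iUnion]
    exact WellFoundedLT.fix_eq _ i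
  have hsmall : ∀ i, #(⋃ j ∈ Iio i, (F j : Set (ℝ × ℝ)) : Set (ℝ × ℝ)) < 𝔠 := by
    intro i
    refine (Cardinal.mk_biUnion_le _ _).trans_lt ?_
    refine Cardinal.mul_lt_of_lt Cardinal.aleph0_le_continuum ?_ ?_
    · simpa using Cardinal.mk_Iio_lt i (by simp)
    exact (ciSup_le' fun j : Iio i => (F j).countable_toSet.le_aleph0).trans_lt
      Cardinal.aleph0_lt_continuum
  have hIic : ∀ i, (⋃ j ∈ Iic i, (F j : Set (ℝ × ℝ))) =
      (⋃ j ∈ Iio i, (F j : Set (ℝ × ℝ))) ∪ F i := by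
    intro i
    rw [← Iio_insert, biUnion_insert, union_comm]
  have hstep : ∀ i, NoThreeCollinear (⋃ j ∈ Iic i, (F j : Set (ℝ × ℝ))) ∧
      HasTwoPoints (⋃ j ∈ Iic i, (F j : Set (ℝ × ℝ))) (lineThrough (line i).1.1 (line i).1.2) := by
    intro i
    induction i using WellFoundedLT.induction with
    | ind i ih =>
      have hIio : NoThreeCollinear (⋃ j ∈ Iio i, (F j : Set (ℝ × ℝ))) :=
        NoThreeCollinear.biUnion fun j hj => (ih j hj).1
      have := hext _ (line i) hIio (hsmall i) (line i).2
      rwa [← hF, ← hIic] at this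
  refine ⟨⋃ i ∈ Set.univ, (F i : Set (ℝ × ℝ)),
    (NoThreeCollinear.biUnion fun j _ => (hstep j).1).isMazurkiewicz fun p v hv => ?_⟩
  obtain ⟨i, hi⟩ := hline ⟨(p, v), hv⟩
  have := (hstep i).2
  rw [hi] at this
  exact this.mono (biUnion_subset_biUnion_left (subset_univ _))

theorem IsMazurkiewicz.nonempty {M : Set (ℝ × ℝ)} (hM : IsMazurkiewicz M) : M.Nonempty := by
  have h := hM (lineThrough 0 (1, 0)) ⟨0, (1, 0), by simp, rfl⟩
  refine Nonempty.left (t := lineThrough 0 (1, 0)) (nonempty_of_encard_ne_zero ?_)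
  simp [h]

theorem IsMazurkiewicz.preimage_add_right {M : Set (ℝ × ℝ)} (hM : IsMazurkiewicz M)
    (a : ℝ × ℝ) : IsMazurkiewicz ((· + a) ⁻¹' M) := by
  rintro _ ⟨p, v, hv, rfl⟩
  have : (· + a) ⁻¹' M ∩ lineThrough p v = (· + a) ⁻¹' (M ∩ lineThrough (p + a) v) := by
    rw [preimage_inter]
    congr 1
    ext q
    simp only [lineThrough, mem_ofPred_eq, mem_preimage, add_right_comm p a, add_left_inj]
  rw [this, encard_preimage_of_bijective (AddGroup.addRight_bijective a)]
  exact hM _ ⟨_, v, hv, rfl⟩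

/-- There is a Mazurkiewicz set containing the origin, and no Mazurkiewicz set
containing the origin is a Hamel basis of `ℝ²`. -/
theorem stmt_4 :
    (∃ M : Set (ℝ × ℝ), IsMazurkiewicz M ∧ ((0 : ℝ), (0 : ℝ)) ∈ M) ∧
      ∀ M : Set (ℝ × ℝ), IsMazurkiewicz M → ((0 : ℝ), (0 : ℝ)) ∈ M →
        ¬ IsHamelBasis M := by
  refine ⟨?_, fun M _ h0 hH => hH.1.ne_zero ⟨_, h0⟩ rfl⟩
  obtain ⟨M, hM⟩ := exists_isMazurkiewicz
  obtain ⟨a, ha⟩ := hM.nonempty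
  exact ⟨_, hM.preimage_add_right a, by simpa [mem_preimage, Prod.mk_zero_zero] using ha⟩
end
end

section
/- There exists a Mazurkiewicz set M ⊆ ℝ × ℝ such that for every θ ∈ ℝ, the rotated set ρ_θ(M) contains the graph of a Sierpiński–Zygmund function, i.e., there is a Sierpiński–Zygmund function f : ℝ → ℝ with {(x, f x) | x ∈ ℝ} ⊆ ρ_θ(M). -/
open Cardinal Set

noncomputable section

/-- The planar cross product of two vectors. -/
def cross (a b : ℝ × ℝ) : ℝ := a.1 * b.2 - a.2 * b.1

theorem mem_lineThrough_iff_cross {p v q : ℝ × ℝ} (hv : v ≠ 0) :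
    q ∈ lineThrough p v ↔ cross (q - p) v = 0 := by
  obtain ⟨p₁, p₂⟩ := p
  obtain ⟨v₁, v₂⟩ := v
  obtain ⟨q₁, q₂⟩ := q
  simp only [lineThrough, mem_ofPred_eq, cross, Prod.smul_mk, Prod.mk_add_mk, Prod.mk.injEq,
    Prod.mk_sub_mk, smul_eq_mul]
  constructor
  · rintro ⟨t, rfl, rfl⟩
    ring
  · intro h
    by_cases h₁ : v₁ = 0
    · have h₂ : v₂ ≠ 0 := by
        rintro rfl
        exact hv (by rw [h₁]; rfl)
      subst h₁
      refine ⟨(q₂ - p₂) / v₂, ?_, ?_⟩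
      · have : (q₁ - p₁) * v₂ = 0 := by linarith
        rcases mul_eq_zero.1 this with h | h
        · linarith
        · exact absurd h h₂
      · field_simp
        ring
    · refine ⟨(q₁ - p₁) / v₁, ?_, ?_⟩
      · field_simp
        ring
      · field_simp
        linarith

theorem cross_add_smul_sub (p v q w : ℝ × ℝ) (t : ℝ) :
    cross (p + t • v - q) w = cross (p - q) w + t * cross v w := by
  simp only [cross, Prod.fst_sub, Prod.snd_sub, Prod.fst_add, Prod.snd_add, Prod.smul_fst,
    Prod.smul_snd, smul_eq_mul]
  ring

/-- If `cross (· - q) w` vanishes at two distinct points of a line, then it vanishes at the base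
point, and the direction of the line is parallel to `w`. -/
theorem cross_eq_zero_of_two_points {p v q w : ℝ × ℝ} {s t : ℝ} (hst : s ≠ t)
    (hs : cross (p + s • v - q) w = 0) (ht : cross (p + t • v - q) w = 0) :
    cross (p - q) w = 0 ∧ cross v w = 0 := by
  rw [cross_add_smul_sub] at hs ht
  have h : (s - t) * cross v w = 0 := by linear_combination hs - ht
  have hvw := (mul_eq_zero.1 h).resolve_left (sub_ne_zero.2 hst)
  exact ⟨by simpa [hvw] using hs, hvw⟩

theorem cross_comm_zero {a b : ℝ × ℝ} (h : cross a b = 0) : cross b a = 0 := by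
  unfold cross at *
  linarith

/-- Being parallel is transitive through a nonzero vector. -/
theorem cross_eq_zero_trans {a b w : ℝ × ℝ} (hw : w ≠ 0) (ha : cross a w = 0)
    (hb : cross b w = 0) : cross a b = 0 := by
  obtain ⟨a₁, a₂⟩ := a
  obtain ⟨b₁, b₂⟩ := b
  obtain ⟨w₁, w₂⟩ := w
  simp only [cross] at *
  by_cases h₁ : w₁ = 0
  · have h₂ : w₂ ≠ 0 := by
      rintro rfl
      exact hw (by rw [h₁]; rfl)
    apply mul_left_cancel₀ h₂
    linear_combination b₂ * ha - a₂ * hb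
  · apply mul_left_cancel₀ h₁
    linear_combination b₁ * ha - a₁ * hb

/-- The vector that the rotation by `θ` makes vertical. -/
def verticalDir (θ : ℝ) : ℝ × ℝ := (Real.sin θ, Real.cos θ)

theorem verticalDir_ne_zero (θ : ℝ) : verticalDir θ ≠ 0 := by
  intro h
  have h₁ : Real.sin θ = 0 := congrArg Prod.fst h
  have h₂ : Real.cos θ = 0 := congrArg Prod.snd h
  have := Real.sin_sq_add_cos_sq θ
  simp [h₁, h₂] at this

theorem cross_sub_verticalDir (θ : ℝ) (p q : ℝ × ℝ) :
    cross (p - q) (verticalDir θ) = (rot θ p).1 - (rot θ q).1 := by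
  simp only [cross, verticalDir, rot, Prod.fst_sub, Prod.snd_sub]
  ring

theorem rot_neg_rot (θ : ℝ) (p : ℝ × ℝ) : rot θ (rot (-θ) p) = p := by
  have h := Real.sin_sq_add_cos_sq θ
  ext <;> simp only [rot, Real.cos_neg, Real.sin_neg]
  · linear_combination p.1 * h
  · linear_combination p.2 * h

theorem rot_injective (θ : ℝ) : Function.Injective (rot θ) := by
  intro p q h
  have key := fun r : ℝ × ℝ => rot_neg_rot (-θ) r
  rw [neg_neg] at key
  rw [← key p, ← key q, h]

/-- The points whose rotation by `θ` is the only point of the closure of `E` on its vertical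
line. -/
def isolatedSlices (θ : ℝ) (E : ℕ → ℝ × ℝ) : Set (ℝ × ℝ) :=
  {p | rot θ p ∈ closure (range E) ∧
    ∀ y, ((rot θ p).1, y) ∈ closure (range E) → y = (rot θ p).2}

theorem eq_of_mem_isolatedSlices {θ : ℝ} {E : ℕ → ℝ × ℝ} {p q : ℝ × ℝ} (hp : p ∈ isolatedSlices θ E)
    (hq : q ∈ isolatedSlices θ E) (h : (rot θ p).1 = (rot θ q).1) : p = q := by
  refine rot_injective θ (Prod.ext h ?_)
  exact hq.2 _ (h ▸ hp.1)

/-- The graph of a continuous partial function consists of isolated slices of the closure of a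
sequence dense in the graph. -/
theorem exists_graph_subset_isolated {S : Set ℝ} (hS : S.Nonempty) {g : S → ℝ}
    (hg : Continuous g) : ∃ E : ℕ → ℝ × ℝ, ∀ x : S,
      ((x : ℝ), g x) ∈ closure (range E) ∧ ∀ y, ((x : ℝ), y) ∈ closure (range E) → y = g x := by
  have : Nonempty S := hS.to_subtype
  let d := TopologicalSpace.denseSeq S
  refine ⟨fun n => ((d n : ℝ), g (d n)), fun x => ⟨?_, fun y hy => ?_⟩⟩
  · have hc : Continuous fun x : S => ((x : ℝ), g x) := continuous_subtype_val.prodMk hg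
    have := image_closure_subset_closure_image hc
      (mem_image_of_mem _ (TopologicalSpace.denseRange_denseSeq S x))
    rwa [← range_comp] at this
  · obtain ⟨u, hu, hlim⟩ := mem_closure_iff_seq_limit.1 hy
    choose k hk using hu
    have h₁ : Filter.Tendsto (fun n => d (k n)) Filter.atTop (nhds x) := by
      rw [tendsto_subtype_rng]
      have := (continuous_fst.tendsto _).comp hlim
      refine this.congr fun n => ?_
      simp [← hk n]
    have h₂ := (hg.tendsto x).comp h₁
    have h₃ := (continuous_snd.tendsto _).comp hlim
    refine tendsto_nhds_unique (h₃.congr fun n => ?_) h₂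
    simp [← hk n]

/-- A line to be met (base point and direction), together with a continuous partial function to be
avoided (an angle and a sequence dense in its graph). -/
abbrev Requirement := (ℝ × ℝ) × {v : ℝ × ℝ // v ≠ 0} × ℝ × (ℕ → ℝ × ℝ)

namespace Requirement

def line (r : Requirement) : Set (ℝ × ℝ) := lineThrough r.1 r.2.1

def direction (r : Requirement) : ℝ × ℝ := r.2.1

def angle (r : Requirement) : ℝ := r.2.2.1

def avoid (r : Requirement) : Set (ℝ × ℝ) := isolatedSlices r.2.2.1 r.2.2.2

theorem mk_eq : #Requirement = Cardinal.continuum := by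
  have hplane : #(ℝ × ℝ) = Cardinal.continuum := by simp [mk_real]
  have hseq : #(ℕ → ℝ × ℝ) = Cardinal.continuum := by simp [mk_real]
  refine le_antisymm ?_ ?_
  · have hv : #{v : ℝ × ℝ // v ≠ 0} ≤ Cardinal.continuum := (mk_subtype_le _).trans hplane.le
    have : #Requirement = #(ℝ × ℝ) * (#{v : ℝ × ℝ // v ≠ 0} * (#ℝ * #(ℕ → ℝ × ℝ))) := by
      simp [Requirement]
    rw [this, hplane, hseq, mk_real]
    calc _ ≤ Cardinal.continuum *
          (Cardinal.continuum * (Cardinal.continuum * Cardinal.continuum)) := by gcongr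
      _ = _ := by simp
  · rw [← mk_real]
    exact mk_le_of_injective (f := fun x : ℝ => ((0, ⟨(1, 0), by simp⟩, x, 0) : Requirement))
      fun x y h => by simpa using h

end Requirement

section Construction

variable {I : Type} [LinearOrder I] (e : I → Requirement)

/-- `p` may be added at stage `a` to the set `B` of points already chosen. -/
structure Admissible (a : I) (B : Set (ℝ × ℝ)) (p : ℝ × ℝ) : Prop where
  mem : p ∈ (e a).line
  notMem : p ∉ B
  few : (B ∩ (e a).line).Subsingleton
  noncollinear : ∀ q ∈ B, ∀ r ∈ B, q ≠ r → cross (p - q) (r - q) ≠ 0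
  fst_ne : ∀ q ∈ B, q ∉ (e a).line → ∀ b < a, (rot (e b).angle p).1 ≠ (rot (e b).angle q).1
  notMem_avoid : ∀ b < a, cross (e a).direction (verticalDir (e b).angle) = 0 → p ∉ (e b).avoid

theorem exists_notMem_iUnion_of_subsingleton {J : Type} (hJ : #J < Cardinal.continuum)
    (s : J → Set ℝ) (hs : ∀ j, (s j).Subsingleton) : ∃ t, ∀ j, t ∉ s j := by
  by_contra! h
  choose j hj using h
  refine (mk_le_of_injective (f := j) fun x y hxy => hs _ (hj x) (hxy ▸ hj y)).not_gt ?_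
  rwa [mk_real]

theorem exists_admissible {a : I} {B : Set (ℝ × ℝ)} (ha : #(Iio a) < Cardinal.continuum)
    (hB : #B < Cardinal.continuum) (few : (B ∩ (e a).line).Subsingleton) :
    ∃ p, Admissible e a B p := by
  obtain ⟨p₀, v, hp₀⟩ : ∃ p₀ v, e a = (p₀, v, (e a).2.2) := ⟨_, _, rfl⟩
  have hline : ∀ q, q ∈ (e a).line ↔ cross (q - p₀) v = 0 := fun q => by
    rw [hp₀]
    exact mem_lineThrough_iff_cross v.2
  have hdir : (e a).direction = v := by rw [hp₀]; rfl
  have hmem : ∀ t : ℝ, p₀ + t • (v : ℝ × ℝ) ∈ (e a).line := fun t => by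
    rw [hp₀]
    exact ⟨t, rfl⟩
  have hon : ∀ {q w : ℝ × ℝ}, w ≠ 0 → cross (p₀ - q) w = 0 → cross v w = 0 →
      q ∈ (e a).line := fun {q w} hw h h' => by
    rw [hline]
    have := cross_eq_zero_trans hw h h'
    simp only [cross, Prod.fst_sub, Prod.snd_sub] at this ⊢
    linarith
  let f : ℝ → ℝ × ℝ := fun t => p₀ + t • (v : ℝ × ℝ)
  have hf : Function.Injective f := fun s t h => by
    simpa [f, v.2] using h
  let s : B ⊕ (B × B) ⊕ (B × Iio a) ⊕ Iio a → Set ℝ := fun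
    | .inl q => {t | f t = q}
    | .inr (.inl (q, r)) => {t | q ≠ r ∧ cross (f t - q) (r - q) = 0}
    | .inr (.inr (.inl (q, b))) => {t | (q : ℝ × ℝ) ∉ (e a).line ∧
        (rot (e b).angle (f t)).1 = (rot (e b).angle q).1}
    | .inr (.inr (.inr b)) => {t | cross (e a).direction (verticalDir (e b).angle) = 0 ∧
        f t ∈ (e b).avoid}
  obtain ⟨t, ht⟩ := exists_notMem_iUnion_of_subsingleton (s := s) (by
      simp only [mk_sum, mk_prod, lift_id]
      have h := aleph0_le_continuum
      exact add_lt_of_lt h hB (add_lt_of_lt h (mul_lt_of_lt h hB hB)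
        (add_lt_of_lt h (mul_lt_of_lt h hB ha) ha))) (by
    rintro (q | ⟨q, r⟩ | ⟨q, b⟩ | b) x hx y hy
    · exact hf (Eq.trans hx (Eq.symm hy))
    · by_contra hxy
      obtain ⟨h, h'⟩ := cross_eq_zero_of_two_points hxy hx.2 hy.2
      have hqr : (r : ℝ × ℝ) - q ≠ 0 := fun h => hx.1 (Subtype.ext (sub_eq_zero.1 h).symm)
      have hq := hon hqr h h'
      have hr : (r : ℝ × ℝ) ∈ (e a).line := by
        refine hon hqr ?_ h'
        simp only [cross, Prod.fst_sub, Prod.snd_sub] at h ⊢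
        linarith
      exact hx.1 (Subtype.ext (few ⟨q.2, hq⟩ ⟨r.2, hr⟩))
    · by_contra hxy
      obtain ⟨h, h'⟩ := cross_eq_zero_of_two_points (q := q) (w := verticalDir (e b).angle) hxy
        (by rw [cross_sub_verticalDir]; exact sub_eq_zero.2 hx.2)
        (by rw [cross_sub_verticalDir]; exact sub_eq_zero.2 hy.2)
      exact hx.1 (hon (verticalDir_ne_zero _) h h')
    · refine hf (eq_of_mem_isolatedSlices hx.2 hy.2 ?_)
      have h : cross v (verticalDir (e b).angle) = 0 := hdir ▸ hx.1
      have hxy : f x - f y = (x - y) • (v : ℝ × ℝ) := by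
        simp only [f, sub_smul, add_sub_add_left_eq_sub]
      have := cross_sub_verticalDir (e b).angle (f x) (f y)
      rw [hxy] at this
      refine sub_eq_zero.1 (this.symm.trans ?_)
      simp only [cross, Prod.smul_fst, Prod.smul_snd, smul_eq_mul] at h ⊢
      linear_combination (x - y) * h)
  refine ⟨f t, hmem t, fun h => ht (.inl ⟨_, h⟩) rfl, few, ?_, ?_, ?_⟩
  · exact fun q hq r hr hqr h =>
      ht (.inr (.inl (⟨q, hq⟩, ⟨r, hr⟩))) ⟨fun h => hqr (congrArg Subtype.val h), h⟩
  · exact fun q hq hqL b hb h => ht (.inr (.inr (.inl (⟨q, hq⟩, ⟨b, hb⟩)))) ⟨hqL, h⟩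
  · exact fun b hb h h' => ht (.inr (.inr (.inr ⟨b, hb⟩))) ⟨h, h'⟩

/-- The singleton of an admissible point if there is one, and the empty set otherwise. -/
def pick (a : I) (B : Set (ℝ × ℝ)) : Set (ℝ × ℝ) :=
  {p | ∃ h : ∃ q, Admissible e a B q, p = h.choose}

variable [WellFoundedLT I]

/-- The set of (at most one) points added at stage `a`. -/
def stage : I → Set (ℝ × ℝ) :=
  wellFounded_lt.fix fun a previous => pick e a (⋃ b : Iio a, previous b b.2)

/-- The set of points added before stage `a`. -/
def before (a : I) : Set (ℝ × ℝ) := ⋃ b : Iio a, stage e b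

theorem stage_eq (a : I) : stage e a = pick e a (before e a) :=
  wellFounded_lt.fix_eq _ a

variable {e}

theorem stage_subsingleton (a : I) : (stage e a).Subsingleton := by
  rw [stage_eq]
  rintro p ⟨h, rfl⟩ q ⟨-, rfl⟩
  rfl

theorem admissible_of_mem_stage {a : I} {p : ℝ × ℝ} (hp : p ∈ stage e a) :
    Admissible e a (before e a) p := by
  rw [stage_eq] at hp
  obtain ⟨h, rfl⟩ := hp
  exact h.choose_spec

theorem mem_before_of_lt {a b : I} (hab : b < a) {p : ℝ × ℝ} (hp : p ∈ stage e b) :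
    p ∈ before e a :=
  mem_iUnion.2 ⟨⟨b, hab⟩, hp⟩

theorem mk_before_le (a : I) : #(before e a) ≤ #(Iio a) := by
  have h : ∀ p : before e a, ∃ b : Iio a, (p : ℝ × ℝ) ∈ stage e b := fun p => mem_iUnion.1 p.2
  choose b hb using h
  exact mk_le_of_injective (f := b) fun p q hpq =>
    Subtype.ext (stage_subsingleton _ (hb p) (hpq ▸ hb q))

theorem stage_nonempty {a : I} (ha : #(Iio a) < Cardinal.continuum)
    (few : (before e a ∩ (e a).line).Subsingleton) : (stage e a).Nonempty := by
  rw [stage_eq]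
  have h := exists_admissible e ha ((mk_before_le a).trans_lt ha) few
  exact ⟨h.choose, h, rfl⟩

theorem before_subset_iUnion_stage (a : I) : before e a ⊆ ⋃ a, stage e a :=
  iUnion_subset fun b => subset_iUnion (stage e) b

/-- No three points of the constructed set are collinear. -/
theorem cross_ne_zero_of_mem_stage {p q r : ℝ × ℝ} {a b c : I} (hp : p ∈ stage e a)
    (hq : q ∈ stage e b) (hr : r ∈ stage e c) (hpq : p ≠ q) (hpr : p ≠ r) (hqr : q ≠ r) :
    cross (p - q) (r - q) ≠ 0 := by
  have ne : ∀ {x y : ℝ × ℝ} {i j : I}, x ∈ stage e i → y ∈ stage e j → x ≠ y → i ≠ j := by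
    rintro x y i _ hx hy hxy rfl
    exact hxy (stage_subsingleton _ hx hy)
  have hab := ne hp hq hpq
  have hac := ne hp hr hpr
  have hbc := ne hq hr hqr
  have last : ∀ {x y z : ℝ × ℝ} {i j k : I}, x ∈ stage e i → y ∈ stage e j → z ∈ stage e k →
      j < i → k < i → y ≠ z → cross (x - y) (z - y) ≠ 0 := fun hx hy hz hj hk h =>
    (admissible_of_mem_stage hx).noncollinear _ (mem_before_of_lt hj hy) _
      (mem_before_of_lt hk hz) h
  intro h
  simp only [cross, Prod.fst_sub, Prod.snd_sub] at last h
  rcases hab.lt_or_gt with h₁ | h₁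
  · rcases hbc.lt_or_gt with h₂ | h₂
    · exact last hr hp hq (h₁.trans h₂) h₂ hpq (by linarith)
    · exact last hq hp hr h₁ h₂ hpr (by linarith)
  · rcases hac.lt_or_gt with h₂ | h₂
    · exact last hr hp hq h₂ (h₁.trans h₂) hpq (by linarith)
    · exact last hp hq hr h₁ h₂ hqr h

/-- A point added after stage `b`, other than the first on its `(e b).angle`-vertical line, is not
in `(e b).avoid`. -/
theorem notMem_avoid_of_mem_before {a b : I} (hba : b < a) {p q : ℝ × ℝ} (hp : p ∈ stage e a)
    (hq : q ∈ before e a) (h : (rot (e b).angle p).1 = (rot (e b).angle q).1) :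
    p ∉ (e b).avoid := by
  have hadm := admissible_of_mem_stage hp
  have hqL : q ∈ (e a).line := by
    by_contra hqL
    exact hadm.fst_ne q hq hqL b hba h
  have hpq : p - q ≠ 0 := fun h => hadm.notMem (sub_eq_zero.1 h ▸ hq)
  refine hadm.notMem_avoid b hba (cross_eq_zero_trans hpq ?_ ?_)
  · have h₁ := (mem_lineThrough_iff_cross (e a).2.1.2).1 hadm.mem
    have h₂ := (mem_lineThrough_iff_cross (e a).2.1.2).1 hqL
    simp only [cross, Requirement.direction, Prod.fst_sub, Prod.snd_sub] at h₁ h₂ ⊢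
    linarith
  · apply cross_comm_zero
    rw [cross_sub_verticalDir, h, sub_self]

theorem isMazurkiewicz_iUnion_stage (hI : ∀ a : I, #(Iio a) < Cardinal.continuum)
    (he : Function.Surjective e) : IsMazurkiewicz (⋃ a, stage e a) := by
  rintro L ⟨p₀, v, hv, rfl⟩
  set M := ⋃ a, stage e a
  apply le_antisymm
  · by_contra! h
    have h₃ : 3 ≤ ((⋃ a, stage e a) ∩ lineThrough p₀ v).encard := by
      simpa [two_add_one_eq_three] using Order.add_one_le_of_lt h
    obtain ⟨T, hT, hT₃⟩ := exists_subset_encard_eq h₃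
    obtain ⟨p, q, r, hpq, hpr, hqr, rfl⟩ := encard_eq_three.1 hT₃
    have hp := hT (show p ∈ _ by simp)
    have hq := hT (show q ∈ _ by simp)
    have hr := hT (show r ∈ _ by simp)
    obtain ⟨⟨a, ha⟩, hpL⟩ := And.imp_left mem_iUnion.1 hp
    obtain ⟨⟨b, hb⟩, hqL⟩ := And.imp_left mem_iUnion.1 hq
    obtain ⟨⟨c, hc⟩, hrL⟩ := And.imp_left mem_iUnion.1 hr
    refine cross_ne_zero_of_mem_stage ha hb hc hpq hpr hqr (cross_eq_zero_trans hv ?_ ?_)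
    all_goals
      rw [mem_lineThrough_iff_cross hv] at hpL hqL hrL
      simp only [cross, Prod.fst_sub, Prod.snd_sub] at hpL hqL hrL ⊢
      linarith
  · by_contra! h
    have hsub : (M ∩ lineThrough p₀ v).Subsingleton := by
      rw [← encard_le_one_iff_subsingleton]
      exact Order.le_of_lt_succ (by simpa [Order.succ_eq_add_one, one_add_one_eq_two] using h)
    obtain ⟨a, ha⟩ := he (p₀, ⟨v, hv⟩, 0, 0)
    obtain ⟨b, hb⟩ := he (p₀, ⟨v, hv⟩, 1, 0)
    have hab : a ≠ b := by
      rintro rfl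
      simpa [Requirement.angle] using congrArg Requirement.angle (ha.symm.trans hb)
    have hline : ∀ c ∈ ({a, b} : Set I), (e c).line = lineThrough p₀ v := by
      rintro c (rfl | rfl)
      · rw [ha]; rfl
      · rw [hb]; rfl
    have new : ∀ c ∈ ({a, b} : Set I), (stage e c).Nonempty := fun c hc =>
      stage_nonempty (hI c) (hsub.anti (by
        rw [hline c hc]
        exact inter_subset_inter_left _ (before_subset_iUnion_stage c)))
    obtain ⟨p, hp⟩ := new a (by simp)
    obtain ⟨q, hq⟩ := new b (by simp)
    have hpq : p = q := hsub
      ⟨mem_iUnion.2 ⟨a, hp⟩, hline a (by simp) ▸ (admissible_of_mem_stage hp).mem⟩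
      ⟨mem_iUnion.2 ⟨b, hq⟩, hline b (by simp) ▸ (admissible_of_mem_stage hq).mem⟩
    rcases hab.lt_or_gt with h | h
    · exact (admissible_of_mem_stage hq).notMem (hpq ▸ mem_before_of_lt h hp)
    · exact (admissible_of_mem_stage hp).notMem (hpq ▸ mem_before_of_lt h hq)

theorem exists_later_point (hM : IsMazurkiewicz (⋃ a, stage e a)) (θ x : ℝ) :
    ∃ a, ∃ p ∈ stage e a, ∃ q ∈ before e a, (rot θ p).1 = x ∧ (rot θ q).1 = x := by
  have key := hM _ ⟨rot (-θ) (x, 0), verticalDir θ, verticalDir_ne_zero θ, rfl⟩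
  obtain ⟨p, q, hpq, heq⟩ := encard_eq_two.1 key
  have hp : p ∈ (⋃ a, stage e a) ∩ _ := heq ▸ mem_insert p {q}
  have hq : q ∈ (⋃ a, stage e a) ∩ _ := heq ▸ mem_insert_of_mem p (mem_singleton q)
  obtain ⟨⟨a, ha⟩, hpL⟩ := And.imp_left mem_iUnion.1 hp
  obtain ⟨⟨b, hb⟩, hqL⟩ := And.imp_left mem_iUnion.1 hq
  rw [mem_lineThrough_iff_cross (verticalDir_ne_zero θ), cross_sub_verticalDir, rot_neg_rot,
    sub_eq_zero] at hpL hqL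
  have hab : a ≠ b := by
    rintro rfl
    exact hpq (stage_subsingleton _ ha hb)
  rcases hab.lt_or_gt with h | h
  · exact ⟨b, q, hb, p, mem_before_of_lt h ha, hqL, hpL⟩
  · exact ⟨a, p, ha, q, mem_before_of_lt h hb, hpL, hqL⟩

theorem exists_isSZFun_graphOf_subset (hI : ∀ a : I, #(Iio a) < Cardinal.continuum)
    (he : Function.Surjective e) (θ : ℝ) :
    ∃ f : ℝ → ℝ, IsSZFun f ∧ graphOf f ⊆ rot θ '' ⋃ a, stage e a := by
  choose a p hp q hq hpx hqx using
    exists_later_point (isMazurkiewicz_iUnion_stage hI he) θ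
  refine ⟨fun x => (rot θ (p x)).2, fun S g hg => ?_, ?_⟩
  · rcases S.eq_empty_or_nonempty with rfl | hS
    · simpa using continuum_pos
    obtain ⟨E, hE⟩ := exists_graph_subset_isolated hS hg
    obtain ⟨b, hb⟩ := he (0, ⟨(1, 0), by simp⟩, θ, E)
    have hle : ∀ x : S, (rot θ (p x)).2 = g x → a x ≤ b := fun x hx => by
      by_contra! hlt
      have hθ : (e b).angle = θ := by rw [hb]; rfl
      refine notMem_avoid_of_mem_before hlt (hp x) (hq x) (by rw [hθ, hpx, hqx]) ?_
      rw [hb]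
      change rot θ (p x) ∈ _ ∧ ∀ y, ((rot θ (p x)).1, y) ∈ _ → y = (rot θ (p x)).2
      have : rot θ (p x) = ((x : ℝ), g x) := Prod.ext (hpx x) hx
      rw [this]
      exact hE x
    have hIic : #(Iic b) < Cardinal.continuum := by
      rw [← Iio_insert]
      exact mk_insert_le.trans_lt
        (add_lt_of_lt aleph0_le_continuum (hI b) (one_lt_aleph0.trans aleph0_lt_continuum))
    refine lt_of_le_of_lt (mk_le_of_injective
      (f := fun x => (⟨a x.1, hle x.1 x.2⟩ : Iic b)) fun x y hxy => ?_) hIic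
    have hxy' : a x.1 = a y.1 := congrArg Subtype.val hxy
    have := stage_subsingleton _ (hp x.1) (hxy' ▸ hp y.1)
    exact Subtype.ext (Subtype.ext (by rw [← hpx x.1, this, hpx y.1]))
  · rintro _ ⟨x, rfl⟩
    exact ⟨p x, mem_iUnion.2 ⟨a x, hp x⟩, Prod.ext (hpx x) rfl⟩

end Construction

/-- There is a Mazurkiewicz set containing the graph of a Sierpiński–Zygmund
function in every direction. -/
theorem stmt_6 :
    ∃ M : Set (ℝ × ℝ), IsMazurkiewicz M ∧
      ∀ θ : ℝ, ∃ f : ℝ → ℝ, IsSZFun f ∧ graphOf f ⊆ rot θ '' M := by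
  have hcard : #(Cardinal.continuum.{0}).ord.ToType = #Requirement := by
    rw [mk_ord_toType, Requirement.mk_eq]
  obtain ⟨e⟩ := Cardinal.eq.1 hcard
  have hI (a : (Cardinal.continuum.{0}).ord.ToType) : #(Iio a) < Cardinal.continuum := by
    simpa using mk_Iio_lt a
  exact ⟨⋃ a, stage e a, isMazurkiewicz_iUnion_stage hI e.surjective,
    exists_isSZFun_graphOf_subset hI e.surjective⟩
end
end

section
/- If M ⊆ ℝ × ℝ is a Mazurkiewicz set that is also a Sierpiński–Zygmund set, then there exists a bijection f : ℝ → ℝ that is a Sierpiński–Zygmund function and whose graph {(x, f x) | x ∈ ℝ} is contained in M. -/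
open Cardinal Set

noncomputable section

/-- In a relation all of whose left sections have exactly `k ≠ 0` elements and whose right
sections have at most `k`, the left side can be matched injectively. -/
theorem exists_injective_of_biregular {α β : Type*} (r : α → β → Prop) {k : ℕ} (hk : k ≠ 0)
    (hl : ∀ a, {b | r a b}.encard = k) (hr : ∀ b, {a | r a b}.encard ≤ k) :
    ∃ f : α → β, Function.Injective f ∧ ∀ a, r a (f a) := by
  classical
  have hfin (a : α) : {b | r a b}.Finite := Set.finite_of_encard_eq_coe (hl a)
  obtain ⟨f, hf, hfr⟩ := (Finset.all_card_le_biUnion_card_iff_exists_injective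
    fun a => (hfin a).toFinset).1 fun s => by
      refine Nat.le_of_mul_le_mul_right (Finset.card_mul_le_card_mul r (m := k) (n := k)
        (fun a ha => ?_) fun b _ => ?_) (Nat.pos_of_ne_zero hk)
      · have hsub : (hfin a).toFinset ⊆
            (s.biUnion fun a => (hfin a).toFinset).bipartiteAbove r a := fun b hb =>
          (Finset.mem_bipartiteAbove r).2
            ⟨Finset.mem_biUnion.2 ⟨a, ha, hb⟩, (hfin a).mem_toFinset.1 hb⟩
        have hcard : (hfin a).toFinset.card = k := by
          have := hl a
          rw [(hfin a).encard_eq_coe_toFinset_card] at this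
          exact_mod_cast this
        exact hcard ▸ Finset.card_le_card hsub
      · have hsub : (↑(s.bipartiteBelow r b) : Set α) ⊆ {a | r a b} := fun a ha =>
          ((Finset.mem_bipartiteBelow r).1 ha).2
        have := (Set.encard_le_encard hsub).trans (hr b)
        rw [Set.encard_coe_eq_coe_finsetCard] at this
        exact_mod_cast this
  exact ⟨f, hf, fun a => (hfin a).mem_toFinset.1 (hfr a)⟩

/-- A `k`-regular relation with `k ≠ 0` contains the graph of a bijection. -/
theorem exists_bijective_of_biregular {α β : Type*} (r : α → β → Prop) {k : ℕ} (hk : k ≠ 0)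
    (hl : ∀ a, {b | r a b}.encard = k) (hr : ∀ b, {a | r a b}.encard = k) :
    ∃ f : α → β, Function.Bijective f ∧ ∀ a, r a (f a) := by
  obtain ⟨f, hf, hfr⟩ := exists_injective_of_biregular r hk hl fun b => (hr b).le
  obtain ⟨g, hg, hgr⟩ :=
    exists_injective_of_biregular (fun b a => r a b) hk hr fun a => (hl a).le
  exact Function.Embedding.schroeder_bernstein_of_rel hf hg r hfr hgr

theorem IsMazurkiewicz.encard_vertical_section {M : Set (ℝ × ℝ)} (hM : IsMazurkiewicz M)
    (x : ℝ) : {y | (x, y) ∈ M}.encard = 2 := by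
  rw [← hM (lineThrough (x, 0) (0, 1)) ⟨_, _, by simp, rfl⟩,
    ← (Prod.mk_right_injective x).encard_image]
  congr 1
  ext ⟨a, b⟩
  simp only [lineThrough, mem_image, mem_inter_iff, mem_ofPred_eq, Prod.mk.injEq, Prod.smul_mk,
    Prod.mk_add_mk, smul_eq_mul, mul_zero, add_zero, mul_one, zero_add]
  aesop

theorem IsMazurkiewicz.encard_horizontal_section {M : Set (ℝ × ℝ)} (hM : IsMazurkiewicz M)
    (y : ℝ) : {x | (x, y) ∈ M}.encard = 2 := by
  rw [← hM (lineThrough (0, y) (1, 0)) ⟨_, _, by simp, rfl⟩,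
    ← (Prod.mk_left_injective y).encard_image]
  congr 1
  ext ⟨a, b⟩
  simp only [lineThrough, mem_image, mem_inter_iff, mem_ofPred_eq, Prod.mk.injEq, Prod.smul_mk,
    Prod.mk_add_mk, smul_eq_mul, mul_zero, add_zero, mul_one, zero_add]
  aesop

/-- A function whose graph lies in a Sierpiński–Zygmund set is a Sierpiński–Zygmund function. -/
theorem IsSZSet.isSZFun {M : Set (ℝ × ℝ)} (hM : IsSZSet M) {f : ℝ → ℝ} (hf : graphOf f ⊆ M) :
    IsSZFun f := fun S g hg => by
  refine lt_of_le_of_lt ?_ (hM S g hg)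
  refine Cardinal.mk_le_of_injective (f := fun x : {x : S | f x.1 = g x} =>
    (⟨(x.1.1, f x.1.1), hf ⟨_, rfl⟩, x.1, Prod.ext rfl x.2⟩ : ↥(M ∩ graphOn S g))) ?_
  intro x y hxy
  exact Subtype.ext (Subtype.ext (congrArg (fun p => p.1.1) hxy))

/-- A Mazurkiewicz set that is Sierpiński–Zygmund contains the graph of a bijective
Sierpiński–Zygmund function. -/
theorem stmt_11 (M : Set (ℝ × ℝ)) (hM : IsMazurkiewicz M) (hSZ : IsSZSet M) :
    ∃ f : ℝ → ℝ, Function.Bijective f ∧ IsSZFun f ∧ graphOf f ⊆ M := by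
  obtain ⟨f, hf, hfM⟩ := exists_bijective_of_biregular (fun x y => (x, y) ∈ M) two_ne_zero
    hM.encard_vertical_section hM.encard_horizontal_section
  have hgraph : graphOf f ⊆ M := by
    rintro _ ⟨x, rfl⟩
    exact hfM x
  exact ⟨f, hf, hSZ.isSZFun hgraph, hgraph⟩
end
end
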